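/- Let (G,Ω) be an abundant transitive ℓ-permutation group whose spine 𝔎 has no minimal element. Let Δ,Δ' ∈ T and h ∈ Q_Δ, h' ∈ Q_{Δ'}. Then κ(Δ) ⊊ κ(Δ') if and only if C²_G(W_{h^g}) ⊊ C²_G(W_{h'}) for some g ∈ G. -/

import Mathlib

/-!  Common framework for ℓ-permutation groups on a totally ordered set. -/

namespace LPerm

variable {Ω : Type*} [LinearOrder Ω]

/-- Pointwise join of two order automorphisms of a totally ordered set. -/
def autSup (f g : Ω ≃o Ω) : Ω ≃o Ω :=
  Equiv.toOrderIso
    { toFun := fun α => max (f α) (g α)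
      invFun := fun α => min (f.symm α) (g.symm α)
      left_inv := by
        intro α
        dsimp only
        rcases le_total (f α) (g α) with h | h
        · rw [max_eq_right h]
          have h1 : α ≤ f.symm (g α) := by
            have := f.symm.monotone h
            simpa using this
          rw [g.symm_apply_apply, min_eq_right h1]
        · rw [max_eq_left h]
          have h1 : α ≤ g.symm (f α) := by
            have := g.symm.monotone h
            simpa using this
          rw [f.symm_apply_apply, min_eq_left h1]
      right_inv := by
        intro α
        dsimp only
        rcases le_total (f.symm α) (g.symm α) with h | h
        · rw [min_eq_left h]
          have h1 : g (f.symm α) ≤ α := by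
            have := g.monotone h
            simpa using this
          rw [f.apply_symm_apply, max_eq_left h1]
        · rw [min_eq_right h]
          have h1 : f (g.symm α) ≤ α := by
            have := f.monotone h
            simpa using this
          rw [g.apply_symm_apply, max_eq_right h1] }
    (f.monotone.max g.monotone)
    (f.symm.monotone.min g.symm.monotone)

/-- Pointwise meet of two order automorphisms of a totally ordered set. -/
def autInf (f g : Ω ≃o Ω) : Ω ≃o Ω :=
  Equiv.toOrderIso
    { toFun := fun α => min (f α) (g α)
      invFun := fun α => max (f.symm α) (g.symm α)
      left_inv := by
        intro α
        dsimp only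
        rcases le_total (f α) (g α) with h | h
        · rw [min_eq_left h]
          have h1 : g.symm (f α) ≤ α := by
            have := g.symm.monotone h
            simpa using this
          rw [f.symm_apply_apply, max_eq_left h1]
        · rw [min_eq_right h]
          have h1 : f.symm (g α) ≤ α := by
            have := f.symm.monotone h
            simpa using this
          rw [g.symm_apply_apply, max_eq_right h1]
      right_inv := by
        intro α
        dsimp only
        rcases le_total (f.symm α) (g.symm α) with h | h
        · rw [max_eq_right h]
          have h1 : α ≤ f (g.symm α) := by
            have := f.monotone h
            simpa using this
          rw [g.apply_symm_apply, min_eq_right h1]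
        · rw [max_eq_left h]
          have h1 : α ≤ g (f.symm α) := by
            have := g.monotone h
            simpa using this
          rw [f.apply_symm_apply, min_eq_left h1] }
    (f.monotone.min g.monotone)
    (f.symm.monotone.max g.symm.monotone)


/-- The pointwise order on order automorphisms: `f ≤ g` iff `f α ≤ g α` for all `α`. -/
def autLe (f g : Ω ≃o Ω) : Prop := ∀ α : Ω, f α ≤ g α

/-- `|g| = g ∨ g⁻¹`. -/
def autAbs (g : Ω ≃o Ω) : Ω ≃o Ω := autSup g g⁻¹

/-- The support of an automorphism. -/
def supp (g : Ω ≃o Ω) : Set Ω := {α | g α ≠ α}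

/-- Conjugation, written `h^g = g⁻¹ h g` in the paper. -/
def aconj (h g : Ω ≃o Ω) : Ω ≃o Ω := g⁻¹ * h * g

/-- The commutator `[a,b] = a⁻¹ b⁻¹ a b`. -/
def pcomm (a b : Ω ≃o Ω) : Ω ≃o Ω := a⁻¹ * b⁻¹ * a * b

/-- `G` is closed under the pointwise lattice operations, i.e. `(G,Ω)` is an
ℓ-permutation group. -/
def SublatticeClosed (G : Subgroup (Ω ≃o Ω)) : Prop :=
  ∀ f g : Ω ≃o Ω, f ∈ G → g ∈ G → autSup f g ∈ G ∧ autInf f g ∈ G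

/-- `(G,Ω)` is transitive. -/
def IsTransitive (G : Subgroup (Ω ≃o Ω)) : Prop :=
  ∀ α β : Ω, ∃ g ∈ G, g α = β

/-- `(G,Ω)` is o-2 transitive. -/
def IsO2Transitive (G : Subgroup (Ω ≃o Ω)) : Prop :=
  ∀ α₁ α₂ β₁ β₂ : Ω, α₁ < α₂ → β₁ < β₂ → ∃ g ∈ G, g α₁ = β₁ ∧ g α₂ = β₂

/-- A convex `G`-congruence: an equivalence relation with convex classes which is
preserved by the action of `G`. -/
def IsConvexCongruence (G : Subgroup (Ω ≃o Ω)) (r : Ω → Ω → Prop) : Prop :=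
  Equivalence r ∧ (∀ α β γ : Ω, r α γ → α ≤ β → β ≤ γ → r α β) ∧
    ∀ g ∈ G, ∀ α β : Ω, r α β → r (g α) (g β)

/-- `V(α,β)`: the intersection of all convex `G`-congruences under which `α` and `β`
are equivalent. -/
def Vcong (G : Subgroup (Ω ≃o Ω)) (α β : Ω) : Ω → Ω → Prop :=
  fun γ δ => ∀ r : Ω → Ω → Prop, IsConvexCongruence G r → r α β → r γ δ

/-- Membership in the spine `𝔎` of `(G,Ω)`. -/
def SpineMem (G : Subgroup (Ω ≃o Ω)) (r : Ω → Ω → Prop) : Prop :=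
  ∃ α β : Ω, α ≠ β ∧ r = Vcong G α β

/-- Inclusion of relations. -/
def relLe (r s : Ω → Ω → Prop) : Prop := ∀ x y : Ω, r x y → s x y

/-- `Δ ∈ T`: `Δ` is an o-block (class) of a member of the spine `𝔎`. -/
def InT (G : Subgroup (Ω ≃o Ω)) (Δ : Set Ω) : Prop :=
  ∃ r : Ω → Ω → Prop, SpineMem G r ∧ ∃ δ : Ω, Δ = {γ | r δ γ}

/-- `Δ` is a class (o-block) of the relation `r`. -/
def IsBlockOf (r : Ω → Ω → Prop) (Δ : Set Ω) : Prop :=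
  ∃ δ : Ω, Δ = {γ | r δ γ}

/-- The restricted stabiliser `rst(S) = {g ∈ G ∣ supp g ⊆ S}`. -/
def rst (G : Subgroup (Ω ≃o Ω)) (S : Set Ω) : Set (Ω ≃o Ω) :=
  {g | g ∈ G ∧ supp g ⊆ S}

/-- The (setwise) stabiliser `st(Δ) = {g ∈ G ∣ Δg = Δ}`. -/
def stab (G : Subgroup (Ω ≃o Ω)) (Δ : Set Ω) : Set (Ω ≃o Ω) :=
  {g | g ∈ G ∧ g '' Δ = Δ}

/-- `Q_Δ = {h ∈ rst(Δ) ∣ ∃ α ∈ Δ, V(α, αh) = κ(Δ)}`; since `κ(Δ)` is the unique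
convex congruence having `Δ` as a class, the condition `V(α,αh) = κ(Δ)` says exactly
that `Δ` is the class of `V(α, αh)` containing `α`. -/
def Qset (G : Subgroup (Ω ≃o Ω)) (Δ : Set Ω) : Set (Ω ≃o Ω) :=
  {h | h ∈ rst G Δ ∧ ∃ α ∈ Δ, Δ = {γ | Vcong G α (h α) α γ}}

/-- `(G,Ω)` is ample: `Q_Δ ≠ ∅` for every `Δ ∈ T`. -/
def Ample (G : Subgroup (Ω ≃o Ω)) : Prop :=
  ∀ Δ : Set Ω, InT G Δ → (Qset G Δ).Nonempty

/-- `(G,Ω)` is abundant: for every `Δ ∈ T` and `g ∈ st(Δ)`, the automorphism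
`dep(g,Δ)` agreeing with `g` on `Δ` and with the identity elsewhere lies in `G`. -/
def Abundant (G : Subgroup (Ω ≃o Ω)) : Prop :=
  ∀ Δ : Set Ω, InT G Δ → ∀ g ∈ stab G Δ,
    ∃ g₀ ∈ G, (∀ α ∈ Δ, g₀ α = g α) ∧ ∀ α ∉ Δ, g₀ α = α

/-- The spine `𝔎` has no minimal element. -/
def SpineNoMin (G : Subgroup (Ω ≃o Ω)) : Prop :=
  ∀ r : Ω → Ω → Prop, SpineMem G r →
    ∃ r' : Ω → Ω → Prop, SpineMem G r' ∧ relLe r' r ∧ r' ≠ r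

/-- `Δ` is a minimal element of `T`. -/
def MinimalInT (G : Subgroup (Ω ≃o Ω)) (Δ : Set Ω) : Prop :=
  InT G Δ ∧ ∀ Δ' : Set Ω, InT G Δ' → Δ' ⊆ Δ → Δ' = Δ

/-- Hypothesis (†): if `T` has a minimal element `Δ₀`, then every (nondegenerate
bounded) interval of `Δ₀` supports a non-trivial element of `G`. -/
def Dagger (G : Subgroup (Ω ≃o Ω)) : Prop :=
  ∀ Δ₀ : Set Ω, MinimalInT G Δ₀ → ∀ α β : Ω, α ∈ Δ₀ → β ∈ Δ₀ → α < β →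
    ∃ g : Ω ≃o Ω, g ∈ G ∧ g ≠ 1 ∧ supp g ⊆ Set.Ioo α β

/-- `X_h = {[h⁻¹, h^g] ∣ g ∈ G}`. -/
def Xset (G : Subgroup (Ω ≃o Ω)) (h : Ω ≃o Ω) : Set (Ω ≃o Ω) :=
  {x | ∃ g ∈ G, x = pcomm h⁻¹ (aconj h g)}

/-- `W_h = ⋃ {X_{h^g} ∣ g ∈ G, [X_h, X_{h^g}] ≠ 1}`. -/
def Wset (G : Subgroup (Ω ≃o Ω)) (h : Ω ≃o Ω) : Set (Ω ≃o Ω) :=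
  {x | ∃ g ∈ G, (∃ a ∈ Xset G h, ∃ b ∈ Xset G (aconj h g), pcomm a b ≠ 1) ∧
    x ∈ Xset G (aconj h g)}

/-- The centraliser of a subset `S` in `G`. -/
def cent (G : Subgroup (Ω ≃o Ω)) (S : Set (Ω ≃o Ω)) : Set (Ω ≃o Ω) :=
  {f | f ∈ G ∧ ∀ s ∈ S, s * f = f * s}

/-- The double centraliser of a subset `S` in `G`. -/
def cent2 (G : Subgroup (Ω ≃o Ω)) (S : Set (Ω ≃o Ω)) : Set (Ω ≃o Ω) :=
  cent G (cent G S)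

/-- The pointwise stabiliser in `G` of a subset `S ⊆ Ω`. -/
def ptStab (G : Subgroup (Ω ≃o Ω)) (S : Set Ω) : Set (Ω ≃o Ω) :=
  {f | f ∈ G ∧ ∀ α ∈ S, f α = α}

/-- The congruence covered by `K`: the union of all convex `G`-congruences properly
contained in `K`. -/
def coveredRel (G : Subgroup (Ω ≃o Ω)) (K : Ω → Ω → Prop) : Ω → Ω → Prop :=
  fun γ δ => ∃ r : Ω → Ω → Prop, IsConvexCongruence G r ∧ relLe r K ∧ r ≠ K ∧ r γ δ

/-- `Γ ∈ π(Δ)`, where `K = κ(Δ)`: `Γ` is a class of the congruence covered by `K`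
contained in `Δ`. -/
def InPi (G : Subgroup (Ω ≃o Ω)) (K : Ω → Ω → Prop) (Δ Γ : Set Ω) : Prop :=
  ∃ δ ∈ Δ, Γ = {γ | coveredRel G K δ γ}

/-- An irreducible element of `G`. -/
def IsIrreducibleElt (G : Subgroup (Ω ≃o Ω)) (g : Ω ≃o Ω) : Prop :=
  autLe 1 g ∧ g ≠ 1 ∧
    ∀ g₁ g₂ : Ω ≃o Ω, g₁ ∈ G → g₂ ∈ G → autSup g₁ g₂ = g → autInf g₁ g₂ = 1 →
      g₁ = 1 ∨ g₂ = 1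

/-- `(G,Ω)` is controlled. -/
def Controlled (G : Subgroup (Ω ≃o Ω)) : Prop :=
  ∀ Δ : Set Ω, InT G Δ → ¬ MinimalInT G Δ → ∀ g ∈ rst G Δ,
    (∃ δ ∈ Δ ∩ supp g, Δ = {γ | Vcong G δ (g δ) δ γ}) ∨
      ∃ Δ' : Set Ω, InT G Δ' ∧ supp g ⊆ Δ' ∧ Δ' ⊂ Δ


section Auxiliary

variable {G : Subgroup (Ω ≃o Ω)}

lemma IsConvexCongruence.map_iff {r : Ω → Ω → Prop} (hr : IsConvexCongruence G r)
    {g : Ω ≃o Ω} (hg : g ∈ G) {x y : Ω} : r (g x) (g y) ↔ r x y := by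
  refine ⟨fun h => ?_, hr.2.2 g hg x y⟩
  simpa using hr.2.2 g⁻¹ (G.inv_mem hg) _ _ h

lemma isConvexCongruence_eq : IsConvexCongruence G (fun x y : Ω => x = y) := by
  refine ⟨⟨fun _ => rfl, fun h => h.symm, fun h h' => h.trans h'⟩, ?_, ?_⟩
  · rintro α β γ rfl h₁ h₂
    exact le_antisymm h₁ h₂
  · rintro g - α β rfl
    rfl

lemma isConvexCongruence_Vcong (α β : Ω) : IsConvexCongruence G (Vcong G α β) := by
  refine ⟨⟨fun x r hr _ => hr.1.refl x, fun h r hr h' => hr.1.symm (h r hr h'),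
    fun h₁ h₂ r hr h' => hr.1.trans (h₁ r hr h') (h₂ r hr h')⟩, ?_, ?_⟩
  · intro x y z h h₁ h₂ r hr h'
    exact hr.2.1 x y z (h r hr h') h₁ h₂
  · intro g hg x y h r hr h'
    exact hr.2.2 g hg x y (h r hr h')

lemma SpineMem.isConvexCongruence {r : Ω → Ω → Prop} (hr : SpineMem G r) :
    IsConvexCongruence G r := by
  obtain ⟨α, β, -, rfl⟩ := hr
  exact isConvexCongruence_Vcong α β

/-- A convex congruence relates every point to some strictly larger point as soon as it relates
two distinct points. -/
lemma IsConvexCongruence.exists_gt (htrans : IsTransitive G) {r : Ω → Ω → Prop}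
    (hr : IsConvexCongruence G r) {a b : Ω} (hab : a ≠ b) (h : r a b) (x : Ω) :
    ∃ y, x < y ∧ r x y := by
  wlog hlt : a < b generalizing a b
  · exact this hab.symm (hr.1.symm h) (lt_of_le_of_ne (not_lt.1 hlt) hab.symm)
  obtain ⟨u, hu, rfl⟩ := htrans a x
  exact ⟨u b, u.lt_iff_lt.2 hlt, hr.2.2 u hu a b h⟩

lemma SpineMem.exists_gt (htrans : IsTransitive G) {r : Ω → Ω → Prop} (hr : SpineMem G r)
    (x : Ω) : ∃ y, x < y ∧ r x y := by
  have hr' := hr.isConvexCongruence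
  obtain ⟨α, β, hne, rfl⟩ := hr
  exact hr'.exists_gt htrans hne (fun r _ h => h) x

/-- The convex congruences of a transitive group form a chain. -/
lemma IsConvexCongruence.total (htrans : IsTransitive G) {r s : Ω → Ω → Prop}
    (hr : IsConvexCongruence G r) (hs : IsConvexCongruence G s) : relLe r s ∨ relLe s r := by
  by_contra! hcon
  obtain ⟨h₁, h₂⟩ := hcon
  simp only [relLe, not_forall] at h₁ h₂
  obtain ⟨a, b, hab, hab'⟩ := h₁
  obtain ⟨c, d, hcd, hcd'⟩ := h₂
  wlog hlt : a < b generalizing a b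
  · refine this b a (hr.1.symm hab) (fun h => hab' (hs.1.symm h)) ?_
    refine lt_of_le_of_ne (not_lt.1 hlt) ?_
    rintro rfl
    exact hab' (hs.1.refl _)
  wlog hlt' : c < d generalizing c d
  · refine this d c (hs.1.symm hcd) (fun h => hcd' (hr.1.symm h)) ?_
    refine lt_of_le_of_ne (not_lt.1 hlt') ?_
    rintro rfl
    exact hcd' (hr.1.refl _)
  obtain ⟨g, hg, rfl⟩ := htrans c a
  rcases le_total b (g d) with h | h
  · exact hab' (hs.2.1 _ _ _ (hs.2.2 g hg _ _ hcd) hlt.le h)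
  · exact hcd' ((hr.map_iff hg).1 (hr.2.1 _ _ _ hab (g.monotone hlt'.le) h))

/-- A convex congruence one of whose classes lies in a class of another one is contained in the
latter. -/
lemma relLe_of_class_subset (htrans : IsTransitive G) {r s : Ω → Ω → Prop}
    (hr : IsConvexCongruence G r) (hs : IsConvexCongruence G s) {δ δ' : Ω}
    (h : {x | r δ x} ⊆ {x | s δ' x}) : relLe r s := by
  intro x y hxy
  obtain ⟨g, hg, rfl⟩ := htrans x δ
  exact (hs.map_iff hg).1 (hs.1.trans (hs.1.symm (h (hr.1.refl _))) (h (hr.2.2 g hg _ _ hxy)))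

lemma exists_spineMem_not_rel (hnomin : SpineNoMin G) {x y : Ω} (hxy : x ≠ y) :
    ∃ r, SpineMem G r ∧ ¬ r x y := by
  obtain ⟨r, hr, hle, hne⟩ := hnomin _ ⟨x, y, hxy, rfl⟩
  refine ⟨r, hr, fun h => hne ?_⟩
  funext a b
  exact propext ⟨hle a b, fun h' => h' r hr.isConvexCongruence h⟩

lemma exists_spineMem_not_rel_two (htrans : IsTransitive G) (hnomin : SpineNoMin G)
    {x y x' y' : Ω} (hxy : x ≠ y) (hxy' : x' ≠ y') :
    ∃ r, SpineMem G r ∧ ¬ r x y ∧ ¬ r x' y' := by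
  obtain ⟨r, hr, h⟩ := exists_spineMem_not_rel hnomin hxy
  obtain ⟨s, hs, h'⟩ := exists_spineMem_not_rel hnomin hxy'
  rcases hr.isConvexCongruence.total htrans hs.isConvexCongruence with hle | hle
  · exact ⟨r, hr, h, fun h₁ => h' (hle _ _ h₁)⟩
  · exact ⟨s, hs, fun h₁ => h (hle _ _ h₁), h'⟩

lemma autSup_apply (f g : Ω ≃o Ω) (x : Ω) : autSup f g x = max (f x) (g x) := rfl

/-- Every class of a member of the spine supports a positive element of `G` moving a prescribed
point. -/
lemma exists_pos_mem_rst (hlat : SublatticeClosed G) (htrans : IsTransitive G)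
    (habund : Abundant G) {r : Ω → Ω → Prop} (hr : SpineMem G r) (x : Ω) :
    ∃ g ∈ G, (∀ y, y ≤ g y) ∧ x < g x ∧ ∀ y, ¬ r x y → g y = y := by
  have hc := hr.isConvexCongruence
  obtain ⟨y, hxy, hrxy⟩ := hr.exists_gt htrans x
  obtain ⟨v, hv, rfl⟩ := htrans x y
  obtain ⟨g, hg, hgin, hgout⟩ := habund {z | r x z} ⟨r, hr, x, rfl⟩ v ⟨hv, by
    ext z
    constructor
    · rintro ⟨w, hw, rfl⟩
      exact hc.1.trans hrxy (hc.2.2 v hv _ _ hw)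
    · intro hz
      refine ⟨v.symm z, (hc.map_iff hv).1 ?_, v.apply_symm_apply z⟩
      rw [v.apply_symm_apply]
      exact hc.1.trans (hc.1.symm hrxy) hz⟩
  refine ⟨autSup g 1, (hlat g 1 hg G.one_mem).1, fun y => le_max_right _ _, ?_, ?_⟩
  · rw [autSup_apply, hgin x (hc.1.refl x)]
    exact lt_max_of_lt_left hxy
  · intro y hy
    rw [autSup_apply, hgout y hy]
    exact max_self y

lemma aconj_mem {h g : Ω ≃o Ω} (hh : h ∈ G) (hg : g ∈ G) : aconj h g ∈ G :=
  G.mul_mem (G.mul_mem (G.inv_mem hg) hh) hg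

lemma Xset_subset {h x : Ω ≃o Ω} (hh : h ∈ G) (hx : x ∈ Xset G h) : x ∈ G := by
  obtain ⟨g, hg, rfl⟩ := hx
  have hk := aconj_mem hh hg
  exact G.mul_mem (G.mul_mem (G.mul_mem (G.inv_mem (G.inv_mem hh)) (G.inv_mem hk))
    (G.inv_mem hh)) hk

lemma pcomm_eq_one_iff {a b : Ω ≃o Ω} : pcomm a b = 1 ↔ a * b = b * a := by
  have : pcomm a b = (b * a)⁻¹ * (a * b) := by simp [pcomm, mul_assoc]
  rw [this, inv_mul_eq_one, eq_comm]

/-- If `h` moves `x` outside its class under a member of the spine, then some element of `X_h`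
moves `x` up and moves no point outside that class up. -/
lemma exists_mem_Xset (hlat : SublatticeClosed G) (htrans : IsTransitive G)
    (habund : Abundant G) {r : Ω → Ω → Prop} (hr : SpineMem G r) {h : Ω ≃o Ω} (hh : h ∈ G)
    {x : Ω} (hx : ¬ r x (h x)) :
    ∃ w ∈ Xset G h, x < w x ∧ ∀ y, ¬ r x y → w y ≤ y := by
  have hc := hr.isConvexCongruence
  obtain ⟨g, hg, hpos, hgx, hfix⟩ := exists_pos_mem_rst hlat htrans habund hr x
  have hfix' : ∀ y, ¬ r x y → g.symm y = y := fun y hy => by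
    rw [OrderIso.symm_apply_eq, hfix y hy]
  have hneg : ∀ y, g.symm y ≤ y := fun y => by simpa using hpos (g.symm y)
  have hmaps : ∀ y, r x y → r x (g y) := fun y hy => by
    by_contra hcon
    rw [← hfix' _ hcon, g.symm_apply_apply] at hcon
    exact hcon hy
  have hmaps' : ∀ y, r x y → r x (g.symm y) := fun y hy => by
    by_contra hcon
    rw [← hfix _ hcon, g.apply_symm_apply] at hcon
    exact hcon hy
  have hoff : ∀ y, r x y → ¬ r x (h y) := fun y hy hy' =>
    hx (hc.1.trans hy' (hc.1.symm (hc.2.2 h hh _ _ hy)))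
  have hoff' : ∀ y, r x y → ¬ r x (h.symm y) := fun y hy hy' =>
    hoff _ hy' (by rwa [h.apply_symm_apply])
  have happ : ∀ y, pcomm h⁻¹ (aconj h g) y =
      h (g.symm (h.symm (g (h.symm (g.symm (h (g y))))))) := by
    intro y
    have : pcomm h⁻¹ (aconj h g) = h * g⁻¹ * h⁻¹ * g * h⁻¹ * g⁻¹ * h * g := by
      simp [pcomm, aconj, mul_assoc]
    rw [this]
    rfl
  refine ⟨_, ⟨g, hg, rfl⟩, ?_, fun y hy => ?_⟩
  · have h₁ : r x (g x) := hmaps x (hc.1.refl x)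
    rw [happ, hfix' _ (hoff _ h₁), h.symm_apply_apply, hfix' _ (hoff' _ (hmaps _ h₁)),
      h.apply_symm_apply]
    exact hgx.trans_le (hpos _)
  · rw [happ, hfix y hy]
    have hle : h.symm (g.symm (h y)) ≤ y := by
      rw [h.symm_apply_le]
      exact hneg _
    have hout : ¬ r x (h.symm (g.symm (h y))) := by
      by_cases hhy : r x (h y)
      · exact hoff' _ (hmaps' _ hhy)
      · rwa [hfix' _ hhy, h.symm_apply_apply]
    rw [hfix _ hout]
    refine le_trans ?_ hle
    rw [← h.le_symm_apply]
    exact hneg _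

/-- An element commuting with `X_h` fixes every point moved by `h`. -/
lemma apply_eq_of_commute_Xset (hlat : SublatticeClosed G) (htrans : IsTransitive G)
    (habund : Abundant G) (hnomin : SpineNoMin G) {h f : Ω ≃o Ω} (hh : h ∈ G)
    (hf : ∀ w ∈ Xset G h, w * f = f * w) {x : Ω} (hx : h x ≠ x) : f x = x := by
  by_contra hfx
  obtain ⟨r, hr, h₁, h₂⟩ := exists_spineMem_not_rel_two htrans hnomin (Ne.symm hfx) (Ne.symm hx)
  obtain ⟨w, hw, hlt, hle⟩ := exists_mem_Xset hlat htrans habund hr hh h₂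
  have hcomm : w (f x) = f (w x) := DFunLike.congr_fun (hf w hw) x
  have := hle (f x) h₁
  rw [hcomm, f.le_iff_le] at this
  exact absurd hlt this.not_gt

/-- If `h` and `k` move a common point then `X_h` and `X_k` do not commute. -/
lemma exists_pcomm_ne_one (hlat : SublatticeClosed G) (htrans : IsTransitive G)
    (habund : Abundant G) (hnomin : SpineNoMin G) {h k : Ω ≃o Ω} (hh : h ∈ G) (hk : k ∈ G)
    {x : Ω} (hx : h x ≠ x) (hx' : k x ≠ x) :
    ∃ a ∈ Xset G h, ∃ b ∈ Xset G k, pcomm a b ≠ 1 := by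
  by_contra! hcon
  obtain ⟨r, hr, h₁⟩ := exists_spineMem_not_rel hnomin hx'.symm
  obtain ⟨w, hw, hlt, -⟩ := exists_mem_Xset hlat htrans habund hr hk h₁
  exact hlt.ne' (apply_eq_of_commute_Xset hlat htrans habund hnomin hh
    (fun a ha => pcomm_eq_one_iff.1 (hcon a ha w hw)) hx)

/-- The points that no element of `G` moving `y` to a point at most `α` moves to a point at
least `γ`. -/
def belowSet (G : Subgroup (Ω ≃o Ω)) (α γ y : Ω) : Set Ω :=
  {t | ∀ z ∈ G, z y ≤ α → z t < γ}

lemma map_mem_belowSet {α γ y t : Ω} {g : Ω ≃o Ω} (hg : g ∈ G) :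
    g t ∈ belowSet G α γ (g y) ↔ t ∈ belowSet G α γ y := by
  constructor
  · intro h z hz hzy
    simpa using h (z * g⁻¹) (G.mul_mem hz (G.inv_mem hg)) (by simpa using hzy)
  · intro h z hz hzy
    exact h (z * g) (G.mul_mem hz hg) hzy

lemma belowSet_mono {α γ x y : Ω} (hxy : x ≤ y) : belowSet G α γ x ⊆ belowSet G α γ y :=
  fun _ ht z hz hzy => ht z hz ((z.monotone hxy).trans hzy)

lemma isConvexCongruence_belowSet (α γ : Ω) :
    IsConvexCongruence G (fun x y => belowSet G α γ x = belowSet G α γ y) := by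
  refine ⟨⟨fun _ => rfl, fun h => h.symm, fun h h' => h.trans h'⟩, ?_, ?_⟩
  · intro x y z h h₁ h₂
    exact (belowSet_mono h₁).antisymm (h ▸ belowSet_mono h₂)
  · intro g hg x y h
    ext t
    obtain ⟨t, rfl⟩ := g.surjective t
    rw [map_mem_belowSet hg, map_mem_belowSet hg, h]

/-- If every convex congruence identifying `α` with `h α` identifies `α` with `γ`, where `α < γ`,
then some conjugate of `h` by an element fixing `α` moves `γ`. -/
lemma exists_stabilizer_conj_moves (hlat : SublatticeClosed G) {h : Ω ≃o Ω} (hh : h ∈ G)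
    {α γ : Ω} (hlt : α < γ) (hr : ∀ r, IsConvexCongruence G r → r α (h α) → r α γ) :
    ∃ z ∈ G, z α = α ∧ h (z γ) ≠ z γ := by
  have hγ : γ ∈ belowSet G α γ γ := fun z _ hz => hz.trans_lt hlt
  have hγ' : γ ∉ belowSet G α γ α := fun hcon => lt_irrefl γ (hcon 1 G.one_mem le_rfl)
  have hne : belowSet G α γ α ≠ belowSet G α γ (h α) := fun hcon =>
    hγ' ((hr _ (isConvexCongruence_belowSet α γ) hcon).symm ▸ hγ)
  obtain ⟨k, hk, hkh, t, ht, ht'⟩ : ∃ k ∈ G, (∀ x, h x = x → k x = x) ∧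
      ∃ t, t ∈ belowSet G α γ (k α) ∧ t ∉ belowSet G α γ α := by
    by_cases hsub : belowSet G α γ (h α) ⊆ belowSet G α γ α
    · obtain ⟨t, ht, ht'⟩ := Set.not_subset.1 fun hcon => hne (hcon.antisymm hsub)
      refine ⟨h⁻¹, G.inv_mem hh, fun x hx => ?_, h⁻¹ t, ?_, ?_⟩
      · exact (h.symm_apply_eq).2 hx.symm
      · rwa [map_mem_belowSet (G.inv_mem hh)]
      · rw [← map_mem_belowSet hh]
        simpa using ht'
    · obtain ⟨t, ht, ht'⟩ := Set.not_subset.1 hsub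
      exact ⟨h, hh, fun _ hx => hx, t, ht, ht'⟩
  simp only [belowSet, Set.mem_ofPred_eq, not_forall, not_lt] at ht'
  obtain ⟨z, hz, hzα, hzt⟩ := ht'
  set v := autSup z 1
  have hvG : v ∈ G := (hlat z 1 hz G.one_mem).1
  have hvα : v α = α := max_eq_right hzα
  have hvt : γ ≤ v t := hzt.trans (le_max_left _ _)
  have hvt' : v t ∈ belowSet G α γ (v (k α)) := (map_mem_belowSet hvG).2 ht
  have hmem : γ ∈ belowSet G α γ (v (k α)) := fun u hu huy =>
    (u.monotone hvt).trans_lt (hvt' u hu huy)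
  refine ⟨v⁻¹, G.inv_mem hvG, (v.symm_apply_eq).2 hvα.symm, fun hfix => hγ' ?_⟩
  have h₁ := (map_mem_belowSet (G.inv_mem hvG)).2 hmem
  rw [← hkh _ hfix, show v⁻¹ (v (k α)) = k α from v.symm_apply_apply _, map_mem_belowSet hk] at h₁
  have h₂ := (map_mem_belowSet hvG).2 h₁
  rwa [hvα, show v (v⁻¹ γ) = γ from v.apply_symm_apply _] at h₂

lemma aconj_apply_ne_iff {h g : Ω ≃o Ω} {x : Ω} : aconj h g x ≠ x ↔ h (g x) ≠ g x := by
  change g.symm (h (g x)) ≠ x ↔ _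
  rw [Ne, g.symm_apply_eq]

lemma exists_conj_moves (hlat : SublatticeClosed G) (htrans : IsTransitive G) {h : Ω ≃o Ω}
    (hh : h ∈ G) {α γ : Ω} (hα : h α ≠ α)
    (hr : ∀ r, IsConvexCongruence G r → r α (h α) → r α γ) :
    ∃ z ∈ G, aconj h z α ≠ α ∧ aconj h z γ ≠ γ := by
  rcases lt_trichotomy α γ with hlt | rfl | hlt
  · obtain ⟨z, hz, hzα, hzγ⟩ := exists_stabilizer_conj_moves hlat hh hlt hr
    exact ⟨z, hz, by rwa [aconj_apply_ne_iff, hzα], aconj_apply_ne_iff.2 hzγ⟩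
  · exact ⟨1, G.one_mem, aconj_apply_ne_iff.2 hα, aconj_apply_ne_iff.2 hα⟩
  · obtain ⟨g, hg, hgγ⟩ := htrans γ α
    obtain ⟨z, hz, hzγ, hzα⟩ := exists_stabilizer_conj_moves hlat (aconj_mem hh hg) hlt (by
      intro r hrc hrel
      have h₁ := hrc.2.2 g hg _ _ hrel
      have h₂ : g (aconj h g γ) = h (g γ) := g.apply_symm_apply _
      rw [h₂, hgγ] at h₁
      exact hrc.1.symm (hr r hrc h₁))
    refine ⟨g * z, G.mul_mem hg hz, ?_, ?_⟩
    · rw [aconj_apply_ne_iff] at hzα ⊢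
      exact hzα
    · rw [aconj_apply_ne_iff, show (g * z) γ = g (z γ) from rfl, hzγ, hgγ]
      exact hα

lemma mul_comm_of_supp_subset {f k : Ω ≃o Ω} {S : Set Ω} (hf : supp f ⊆ S)
    (hk : ∀ x ∈ S, k x = x) : k * f = f * k := by
  have hf' : ∀ x, x ∉ S → f x = x := fun x hx => by_contra fun hcon => hx (hf hcon)
  ext x
  change k (f x) = f (k x)
  by_cases hx : x ∈ S
  · rw [hk x hx]
    by_cases hfx : f x ∈ S
    · exact hk _ hfx
    · have : f x = x := f.injective (hf' _ hfx)
      rw [this, hk x hx]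
  · rw [hf' x hx]
    by_cases hkx : k x ∈ S
    · have : k x = x := k.injective (hk _ hkx)
      rw [this, hf' x hx]
    · exact (hf' _ hkx).symm

lemma supp_pcomm_subset {a b : Ω ≃o Ω} {S : Set Ω} (ha : supp a ⊆ S) (hb : supp b ⊆ S) :
    supp (pcomm a b) ⊆ S := by
  intro x hx
  by_contra hxS
  have ha' : a x = x := by_contra fun hcon => hxS (ha hcon)
  have hb' : b x = x := by_contra fun hcon => hxS (hb hcon)
  apply hx
  change a.symm (b.symm (a (b x))) = x
  rw [hb', ha', b.symm_apply_eq.2 hb'.symm, a.symm_apply_eq.2 ha'.symm]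

lemma supp_inv (a : Ω ≃o Ω) : supp a⁻¹ = supp a := by
  ext x
  change a.symm x ≠ x ↔ a x ≠ x
  rw [Ne, a.symm_apply_eq, eq_comm]

/-- A conjugate of an element supported on a class is supported on that class or fixes it
pointwise. -/
lemma supp_aconj_subset_or {r : Ω → Ω → Prop} (hr : IsConvexCongruence G r) {δ : Ω}
    {h g : Ω ≃o Ω} (hh : supp h ⊆ {x | r δ x}) (hg : g ∈ G) :
    supp (aconj h g) ⊆ {x | r δ x} ∨ ∀ x, r δ x → ¬ r δ (g x) := by
  by_contra! hcon
  obtain ⟨hns, y, hy, hgy⟩ := hcon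
  refine hns fun x hx => ?_
  have hx' : r δ (g x) := hh (aconj_apply_ne_iff.1 hx)
  exact hr.1.trans hy ((hr.map_iff hg).1 (hr.1.trans (hr.1.symm hgy) hx'))

lemma supp_subset_of_mem_Xset {r : Ω → Ω → Prop} (hr : IsConvexCongruence G r) {δ : Ω}
    {h w : Ω ≃o Ω} (hh : supp h ⊆ {x | r δ x}) (hw : w ∈ Xset G h) : supp w ⊆ {x | r δ x} := by
  obtain ⟨g, hg, rfl⟩ := hw
  rcases supp_aconj_subset_or hr hh hg with hs | hs
  · exact supp_pcomm_subset (by rwa [supp_inv]) hs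
  · have hfix : ∀ x ∈ {x | r δ x}, aconj h g x = x := fun x hx => by
      by_contra hcon
      exact hs x hx (hh (aconj_apply_ne_iff.1 hcon))
    rw [pcomm_eq_one_iff.2 (mul_comm_of_supp_subset (by rwa [supp_inv]) hfix).symm]
    exact fun x hx => absurd rfl hx

lemma supp_subset_of_mem_Wset {r : Ω → Ω → Prop} (hr : IsConvexCongruence G r) {δ : Ω}
    {h w : Ω ≃o Ω} (hh : supp h ⊆ {x | r δ x}) (hw : w ∈ Wset G h) : supp w ⊆ {x | r δ x} := by
  obtain ⟨g, hg, ⟨a, ha, b, hb, hab⟩, hw⟩ := hw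
  rcases supp_aconj_subset_or hr hh hg with hs | hs
  · exact supp_subset_of_mem_Xset hr hs hw
  · refine absurd (pcomm_eq_one_iff.2 ?_) hab
    refine (mul_comm_of_supp_subset (supp_subset_of_mem_Xset hr hh ha) fun x hx => ?_).symm
    have hsupp : supp (aconj h g) ⊆ {x | r (g⁻¹ δ) x} := fun y hy => by
      refine (hr.map_iff hg).1 ?_
      rw [show g (g⁻¹ δ) = δ from g.apply_symm_apply δ]
      exact hh (aconj_apply_ne_iff.1 hy)
    by_contra hcon
    have hrel := (hr.map_iff hg).2 (supp_subset_of_mem_Xset hr hsupp hb hcon)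
    rw [show g (g⁻¹ δ) = δ from g.apply_symm_apply δ] at hrel
    exact hs x hx hrel

lemma cent_Wset (hlat : SublatticeClosed G) (htrans : IsTransitive G) (habund : Abundant G)
    (hnomin : SpineNoMin G) {Δ : Set Ω} (hΔ : InT G Δ) {h : Ω ≃o Ω} (hh : h ∈ Qset G Δ) :
    cent G (Wset G h) = ptStab G Δ := by
  obtain ⟨⟨hhG, hsupp⟩, α, hα, hclass⟩ := hh
  obtain ⟨r, hr, δ, rfl⟩ := hΔ
  have hc := hr.isConvexCongruence
  ext f
  refine ⟨fun ⟨hf, hcomm⟩ => ⟨hf, fun γ hγ => ?_⟩, fun ⟨hf, hfix⟩ => ⟨hf, fun w hw => ?_⟩⟩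
  · have hne : h α ≠ α := by
      intro hcon
      obtain ⟨y, hy, hry⟩ := hr.exists_gt htrans α
      have hy' : y ∈ {x | r δ x} := hc.1.trans hα hry
      rw [hclass] at hy'
      exact hy.ne (hy' _ isConvexCongruence_eq hcon.symm)
    rw [hclass] at hγ
    obtain ⟨z, hz, hzα, hzγ⟩ := exists_conj_moves hlat htrans hhG hne fun s hs hrel => hγ s hs hrel
    refine apply_eq_of_commute_Xset hlat htrans habund hnomin (aconj_mem hhG hz)
      (fun w hw => hcomm w ⟨z, hz, ?_, hw⟩) hzγ
    exact exists_pcomm_ne_one hlat htrans habund hnomin hhG (aconj_mem hhG hz) hne hzα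
  · exact (mul_comm_of_supp_subset (supp_subset_of_mem_Wset hc hsupp hw) hfix).symm

lemma cent_ptStab (hlat : SublatticeClosed G) (htrans : IsTransitive G) (habund : Abundant G)
    (hnomin : SpineNoMin G) {Δ : Set Ω} (hΔ : InT G Δ) :
    cent G (ptStab G Δ) = rst G Δ := by
  obtain ⟨r, hr, δ, rfl⟩ := hΔ
  have hc := hr.isConvexCongruence
  ext f
  refine ⟨fun ⟨hf, hcomm⟩ => ⟨hf, fun γ hγ => ?_⟩, fun ⟨hf, hsupp⟩ => ⟨hf, fun k hk => ?_⟩⟩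
  · by_contra hγΔ
    have hγδ : γ ≠ δ := by
      rintro rfl
      exact hγΔ (hc.1.refl γ)
    obtain ⟨s, hs, h₁, h₂⟩ := exists_spineMem_not_rel_two htrans hnomin (Ne.symm hγ) hγδ
    have hsc := hs.isConvexCongruence
    obtain ⟨g, hg, -, hlt, hfix⟩ := exists_pos_mem_rst hlat htrans habund hs γ
    have hgmem : g ∈ ptStab G {x | r δ x} := by
      refine ⟨hg, fun y hy => hfix y fun hcon => ?_⟩
      rcases hsc.total htrans hc with hle | hle
      · exact hγΔ (hc.1.trans hy (hc.1.symm (hle _ _ hcon)))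
      · exact h₂ (hsc.1.trans hcon (hsc.1.symm (hle _ _ hy)))
    have : g (f γ) = f (g γ) := DFunLike.congr_fun (hcomm g hgmem) γ
    rw [hfix _ h₁] at this
    exact hlt.ne (f.injective this)
  · exact mul_comm_of_supp_subset hsupp hk.2

lemma cent2_Wset (hlat : SublatticeClosed G) (htrans : IsTransitive G) (habund : Abundant G)
    (hnomin : SpineNoMin G) {Δ : Set Ω} (hΔ : InT G Δ) {h : Ω ≃o Ω} (hh : h ∈ Qset G Δ) :
    cent2 G (Wset G h) = rst G Δ := by
  rw [cent2, cent_Wset hlat htrans habund hnomin hΔ hh, cent_ptStab hlat htrans habund hnomin hΔ]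

lemma rst_subset_rst_iff (hlat : SublatticeClosed G) (htrans : IsTransitive G)
    (habund : Abundant G) {Δ Δ' : Set Ω} (hΔ : InT G Δ) : rst G Δ ⊆ rst G Δ' ↔ Δ ⊆ Δ' := by
  refine ⟨fun h x hx => ?_, fun h g hg => ⟨hg.1, hg.2.trans h⟩⟩
  obtain ⟨r, hr, δ, rfl⟩ := hΔ
  obtain ⟨g, hg, -, hlt, hfix⟩ := exists_pos_mem_rst hlat htrans habund hr x
  refine (h ⟨hg, fun y hy => ?_⟩).2 hlt.ne'
  exact hr.isConvexCongruence.1.trans hx (not_not.1 fun hcon => hy (hfix y hcon))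

lemma rst_ssubset_rst_iff (hlat : SublatticeClosed G) (htrans : IsTransitive G)
    (habund : Abundant G) {Δ Δ' : Set Ω} (hΔ : InT G Δ) (hΔ' : InT G Δ') :
    rst G Δ ⊂ rst G Δ' ↔ Δ ⊂ Δ' := by
  rw [ssubset_iff_subset_not_subset, ssubset_iff_subset_not_subset,
    rst_subset_rst_iff hlat htrans habund hΔ, rst_subset_rst_iff hlat htrans habund hΔ']

lemma IsConvexCongruence.preimage_class {r : Ω → Ω → Prop} (hr : IsConvexCongruence G r)
    {g : Ω ≃o Ω} (hg : g ∈ G) (δ : Ω) : g ⁻¹' {x | r δ x} = {x | r (g⁻¹ δ) x} := by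
  ext x
  have := hr.map_iff hg (x := g⁻¹ δ) (y := x)
  rwa [show g (g⁻¹ δ) = δ from g.apply_symm_apply δ] at this

lemma InT.preimage {Δ : Set Ω} (hΔ : InT G Δ) {g : Ω ≃o Ω} (hg : g ∈ G) :
    InT G (g ⁻¹' Δ) := by
  obtain ⟨r, hr, δ, rfl⟩ := hΔ
  exact ⟨r, hr, g⁻¹ δ, hr.isConvexCongruence.preimage_class hg δ⟩

lemma Vcong_map {g : Ω ≃o Ω} (hg : g ∈ G) (α β : Ω) :
    Vcong G (g α) (g β) = Vcong G α β := by
  funext x y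
  refine propext ⟨fun h r hr hrel => ?_, fun h r hr hrel => ?_⟩
  · exact h r hr (hr.2.2 g hg _ _ hrel)
  · exact h r hr ((hr.map_iff hg).1 hrel)

lemma aconj_mem_Qset {Δ : Set Ω} {h : Ω ≃o Ω} (hh : h ∈ Qset G Δ) {g : Ω ≃o Ω} (hg : g ∈ G) :
    aconj h g ∈ Qset G (g ⁻¹' Δ) := by
  obtain ⟨⟨hhG, hsupp⟩, α, hα, hclass⟩ := hh
  have hg' := G.inv_mem hg
  refine ⟨⟨aconj_mem hhG hg, fun x hx => hsupp (aconj_apply_ne_iff.1 hx)⟩, g⁻¹ α, ?_, ?_⟩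
  · rwa [Set.mem_preimage, show g (g⁻¹ α) = α from g.apply_symm_apply α]
  · have : aconj h g (g⁻¹ α) = g⁻¹ (h α) := by simp [aconj]
    rw [this, Vcong_map hg', ← (isConvexCongruence_Vcong α (h α)).preimage_class hg, ← hclass]

end Auxiliary

/-- (Corollary 4.6 of the paper.)  Here `K = κ(Δ)` and
`K' = κ(Δ')` are the (unique) convex congruences having `Δ`, `Δ'` as classes. -/
theorem kappa_lt_iff_double_centralizer {Ω : Type*} [LinearOrder Ω]
    (G : Subgroup (Ω ≃o Ω)) (hlat : SublatticeClosed G)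
    (htrans : IsTransitive G) (habund : Abundant G) (hnomin : SpineNoMin G)
    (Δ Δ' : Set Ω) (hΔ : InT G Δ) (hΔ' : InT G Δ')
    (K K' : Ω → Ω → Prop) (hK : IsConvexCongruence G K)
    (hK' : IsConvexCongruence G K') (hKΔ : IsBlockOf K Δ) (hK'Δ' : IsBlockOf K' Δ')
    (h h' : Ω ≃o Ω) (hh : h ∈ Qset G Δ) (hh' : h' ∈ Qset G Δ') :
    (relLe K K' ∧ K ≠ K') ↔
      ∃ g ∈ G, cent2 G (Wset G (aconj h g)) ⊂ cent2 G (Wset G h') := by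
  have key : ∀ g ∈ G, (cent2 G (Wset G (aconj h g)) ⊂ cent2 G (Wset G h') ↔ g ⁻¹' Δ ⊂ Δ') := by
    intro g hg
    rw [cent2_Wset hlat htrans habund hnomin (hΔ.preimage hg) (aconj_mem_Qset hh hg),
      cent2_Wset hlat htrans habund hnomin hΔ' hh',
      rst_ssubset_rst_iff hlat htrans habund (hΔ.preimage hg) hΔ']
  obtain ⟨δ, rfl⟩ := hKΔ
  obtain ⟨δ', rfl⟩ := hK'Δ'
  constructor
  · rintro ⟨hle, hne⟩
    obtain ⟨g, hg, rfl⟩ := htrans δ' δ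
    refine ⟨g, hg, (key g hg).2 ?_⟩
    rw [hK.preimage_class hg, show g⁻¹ (g δ') = δ' from g.symm_apply_apply δ']
    refine ⟨fun x => hle δ' x, fun hsub => hne ?_⟩
    funext x y
    exact propext ⟨hle x y, relLe_of_class_subset htrans hK' hK hsub x y⟩
  · rintro ⟨g, hg, hlt⟩
    rw [key g hg, hK.preimage_class hg] at hlt
    refine ⟨relLe_of_class_subset htrans hK hK' hlt.1, ?_⟩
    rintro rfl
    exact hlt.2 fun x hx => hK.1.trans (hK.1.symm (hlt.1 (hK.1.refl _))) hx

end LPerm
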